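/- Let k ∈ ℕ with k ≥ 2 and let f be a non-constant entire function such that S_k(f)(z) ≠ 0 and S_k(f)(z) ≠ ∞ for all z ∈ ℂ (i.e., S_k(f) is an entire function with no zeros). Then there exist a, b, c ∈ ℂ with a ≠ 0 and b ≠ 0 such that f(z) = a·e^{bz} + c for all z ∈ ℂ. -/

import Mathlib

open Complex Filter Set Metric Topology

noncomputable section

/-- The open unit disk `𝔻`. -/
def unitDisk : Set ℂ := Metric.ball (0 : ℂ) 1

/-- The logarithmic derivative of `f'`, i.e. `f''/f'`. -/
def ldd (f : ℂ → ℂ) : ℂ → ℂ := fun z => deriv (deriv f) z / deriv f z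

/-- `SRec n f m` is the generalized Schwarzian `S_{m+2,n}(f)`. -/
def SRec (n : ℕ) (f : ℂ → ℂ) : ℕ → ℂ → ℂ
  | 0 => ldd f
  | m + 1 => fun z => deriv (SRec n f m) z - (1 / (n : ℂ)) * ldd f z * SRec n f m z

/-- `SGen n k f` is `S_{k,n}(f)` (for `k ≥ 2`). -/
def SGen (n k : ℕ) (f : ℂ → ℂ) : ℂ → ℂ := SRec n f (k - 2)

/-- The generalized Schwarzian derivative of order `k`: `S_k(f) = S_{k+1,k}(f)`. -/
def Sk (k : ℕ) (f : ℂ → ℂ) : ℂ → ℂ := SGen k (k + 1) f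

/-- `f` is a non-constant meromorphic function on `U`: near no point of `U`
is `f` eventually equal to a constant. -/
def NonConstOn (f : ℂ → ℂ) (U : Set ℂ) : Prop :=
  ¬ ∃ c : ℂ, ∃ z ∈ U, ∀ᶠ w in 𝓝[≠] z, f w = c

/-- `E` has no accumulation point in `U`. -/
def NoAccIn (E U : Set ℂ) : Prop := ∀ z ∈ U, ¬ AccPt z (𝓟 E)

/-- The family `M_{k,M}`: (non-constant) meromorphic functions on `𝔻` whose generalized
Schwarzian derivative `S_k(f)` is holomorphic on `𝔻` with `‖S_k(f)‖_∞ ≤ M`, i.e. it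
coincides (away from a set without accumulation points in `𝔻`) with a function `g`
holomorphic on `𝔻` and bounded by `M`. -/
def MFam (k : ℕ) (M : ℝ) : Set (ℂ → ℂ) :=
  {f | MeromorphicOn f unitDisk ∧ NonConstOn f unitDisk ∧
    ∃ g : ℂ → ℂ, AnalyticOnNhd ℂ g unitDisk ∧ (∀ z ∈ unitDisk, ‖g z‖ ≤ M) ∧
      NoAccIn {w ∈ unitDisk | Sk k f w ≠ g w} unitDisk}

/-- The family `H_{k,M} = M_{k,M} ∩ H(𝔻)`. -/
def HFam (k : ℕ) (M : ℝ) : Set (ℂ → ℂ) :=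
  {f ∈ MFam k M | AnalyticOnNhd ℂ f unitDisk}

/-- The chordal (spherical) distance on the Riemann sphere `ℂ ∪ {∞}`. -/
def sphDist (x y : OnePoint ℂ) : ℝ :=
  Option.elim x (Option.elim y 0 fun w => 1 / Real.sqrt (1 + ‖w‖ ^ 2))
    fun z =>
      Option.elim y (1 / Real.sqrt (1 + ‖z‖ ^ 2)) fun w =>
        ‖z - w‖ / (Real.sqrt (1 + ‖z‖ ^ 2) * Real.sqrt (1 + ‖w‖ ^ 2))

/-- Locally uniform convergence on `U` with respect to the spherical metric. -/
def TendstoLocUnifSph (F : ℕ → ℂ → ℂ) (g : ℂ → OnePoint ℂ) (U : Set ℂ) : Prop :=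
  ∀ ε > (0 : ℝ), ∀ x ∈ U, ∃ t ∈ 𝓝[U] x,
    ∀ᶠ n in atTop, ∀ y ∈ t, sphDist (F n y : OnePoint ℂ) (g y) < ε

/-- A family of (meromorphic) functions is normal on `U` if every sequence has a
subsequence converging locally uniformly on `U` w.r.t. the spherical metric. -/
def NormalOn (𝓕 : Set (ℂ → ℂ)) (U : Set ℂ) : Prop :=
  ∀ F : ℕ → ℂ → ℂ, (∀ n, F n ∈ 𝓕) →
    ∃ φ : ℕ → ℕ, StrictMono φ ∧
      ∃ g : ℂ → OnePoint ℂ, TendstoLocUnifSph (fun n => F (φ n)) g U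

/-- A family is quasi-normal on `U` if every sequence has a subsequence converging
locally uniformly (spherically) off some exceptional set `E ⊆ U` without
accumulation points in `U`. -/
def QuasiNormalOn (𝓕 : Set (ℂ → ℂ)) (U : Set ℂ) : Prop :=
  ∀ F : ℕ → ℂ → ℂ, (∀ n, F n ∈ 𝓕) →
    ∃ φ : ℕ → ℕ, StrictMono φ ∧ ∃ E : Set ℂ, E ⊆ U ∧ NoAccIn E U ∧
      ∃ g : ℂ → OnePoint ℂ, TendstoLocUnifSph (fun n => F (φ n)) g (U \ E)

/-- A family is locally uniformly bounded on `U`. -/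
def LocUnifBddOn (𝓕 : Set (ℂ → ℂ)) (U : Set ℂ) : Prop :=
  ∀ x ∈ U, ∃ t ∈ 𝓝[U] x, ∃ C : ℝ, ∀ f ∈ 𝓕, ∀ y ∈ t, ‖f y‖ ≤ C

/-- `logDerivPoly g k` is the differential polynomial in `g` equal to `h^{(k)} / h` when
`h' / h = g`. -/
def logDerivPoly (g : ℂ → ℂ) : ℕ → ℂ → ℂ
  | 0 => fun _ => 1
  | k + 1 => fun z => deriv (logDerivPoly g k) z + g z * logDerivPoly g k z

/-- `recipPoly w k` is the differential polynomial in `w` equal to `logDerivPoly g k / g ^ k`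
when `w = 1 / g`. -/
def recipPoly (w : ℂ → ℂ) : ℕ → ℂ → ℂ
  | 0 => fun _ => 1
  | k + 1 => fun z =>
      recipPoly w k z + w z * deriv (recipPoly w k) z - k * deriv w z * recipPoly w k z

lemma logDerivPoly_succ (g : ℂ → ℂ) (k : ℕ) (z : ℂ) :
    logDerivPoly g (k + 1) z = deriv (logDerivPoly g k) z + g z * logDerivPoly g k z := rfl

lemma recipPoly_succ (w : ℂ → ℂ) (k : ℕ) (z : ℂ) : recipPoly w (k + 1) z =
    recipPoly w k z + w z * deriv (recipPoly w k) z - k * deriv w z * recipPoly w k z := rfl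

lemma differentiable_deriv_of_entire {g : ℂ → ℂ} (hg : Differentiable ℂ g) :
    Differentiable ℂ (deriv g) :=
  differentiableOn_univ.1 (hg.differentiableOn.deriv isOpen_univ)

lemma differentiable_logDerivPoly {g : ℂ → ℂ} (hg : Differentiable ℂ g) (k : ℕ) :
    Differentiable ℂ (logDerivPoly g k) := by
  induction k with
  | zero => exact differentiable_const _
  | succ k ih => exact (differentiable_deriv_of_entire ih).add (hg.mul ih)

lemma differentiableOn_recipPoly {w : ℂ → ℂ} {U : Set ℂ} (hU : IsOpen U)
    (hw : DifferentiableOn ℂ w U) (k : ℕ) : DifferentiableOn ℂ (recipPoly w k) U := by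
  induction k with
  | zero => exact differentiableOn_const _
  | succ k ih =>
    exact (ih.add (hw.mul (ih.deriv hU))).sub (((hw.deriv hU).const_mul _).mul ih)

lemma SRec_eq_logDerivPoly {n : ℕ} (hn : n ≠ 0) {f : ℂ → ℂ}
    (hu : Differentiable ℂ fun z => -(1 / (n : ℂ)) * ldd f z) (m : ℕ) :
    SRec n f m =
      fun z => -(n : ℂ) * logDerivPoly (fun z => -(1 / (n : ℂ)) * ldd f z) (m + 1) z := by
  have hn' : (n : ℂ) ≠ 0 := Nat.cast_ne_zero.2 hn
  induction m with
  | zero =>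
    funext z
    simp only [SRec, logDerivPoly, deriv_const]
    field_simp
    ring
  | succ m ih =>
    funext z
    have hd := deriv_const_mul (-(n : ℂ)) ((differentiable_logDerivPoly hu (m + 1)) z)
    rw [logDerivPoly_succ _ (m + 1)]
    simp only [SRec]
    rw [ih, hd]
    ring

lemma logDerivPoly_comp_affine {g : ℂ → ℂ} (hg : Differentiable ℂ g) (μ ν : ℂ) (k : ℕ) :
    logDerivPoly (fun z => μ * g (μ * z + ν)) k =
      fun z => μ ^ k * logDerivPoly g k (μ * z + ν) := by
  induction k with
  | zero => simp [logDerivPoly]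
  | succ k ih =>
    funext z
    have h1 : HasDerivAt (fun z : ℂ => μ * z + ν) μ z := by
      simpa using ((hasDerivAt_id z).const_mul μ).add_const ν
    have h2 := ((differentiable_logDerivPoly hg k) (μ * z + ν)).hasDerivAt.comp z h1
    have h3 : HasDerivAt (fun z => μ ^ k * logDerivPoly g k (μ * z + ν))
        (μ ^ k * (deriv (logDerivPoly g k) (μ * z + ν) * μ)) z := h2.const_mul (μ ^ k)
    rw [logDerivPoly_succ, logDerivPoly_succ, ih, h3.deriv]
    ring

lemma tendsto_logDerivPoly {ι : Type*} {l : Filter ι} [l.NeBot] {F : ι → ℂ → ℂ} {g : ℂ → ℂ}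
    (hF : ∀ n, Differentiable ℂ (F n)) (h : TendstoLocallyUniformlyOn F g l univ) (k : ℕ) :
    TendstoLocallyUniformlyOn (fun n => logDerivPoly (F n) k) (logDerivPoly g k) l univ := by
  have hg : Differentiable ℂ g := differentiableOn_univ.1
    (h.differentiableOn (.of_forall fun n => (hF n).differentiableOn) isOpen_univ)
  induction k with
  | zero =>
    intro u hu x _
    exact ⟨univ, univ_mem, .of_forall fun n y _ => refl_mem_uniformity hu⟩
  | succ k ih =>
    have hd := ih.deriv
      (.of_forall fun n => (differentiable_logDerivPoly (hF n) k).differentiableOn) isOpen_univ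
    exact hd.add (h.mul₀ ih hg.continuous.continuousOn
      (differentiable_logDerivPoly hg k).continuous.continuousOn)

lemma norm_deriv_le_of_forall_mem_ball {F : ℂ → ℂ} {a : ℂ} {r C : ℝ} (hr : 0 < r)
    (hF : DifferentiableOn ℂ F (ball a r)) (h : ∀ z ∈ ball a r, ‖F z‖ ≤ C) :
    ‖deriv F a‖ ≤ C / (r / 2) := by
  have hsub : closedBall a (r / 2) ⊆ ball a r := closedBall_subset_ball (by linarith)
  refine norm_deriv_le_of_forall_mem_sphere_norm_le (by linarith) ?_ fun z hz =>
    h z (hsub (sphere_subset_closedBall hz))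
  exact (hF.mono hsub).diffContOnCl_ball subset_rfl

lemma ball_half_subset_ball {a b : ℂ} {s : ℝ} (hb : b ∈ ball a (s / 2)) :
    ball b (s / 2) ⊆ ball a s := by
  intro z hz
  rw [mem_ball] at *
  linarith [dist_triangle z b a]

lemma exists_norm_logDerivPoly_le (k : ℕ) : ∀ s > 0, ∀ M : ℝ, ∃ A : ℝ, ∀ (g : ℂ → ℂ) (a : ℂ),
    Differentiable ℂ g → (∀ z ∈ ball a s, ‖g z‖ ≤ M) → ‖logDerivPoly g k a‖ ≤ A := by
  induction k with
  | zero => exact fun s hs M => ⟨1, fun g a _ _ => by simp [logDerivPoly]⟩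
  | succ k ih =>
    intro s hs M
    obtain ⟨A, hA⟩ := ih (s / 2) (by linarith) M
    refine ⟨A / (s / 2 / 2) + M * A, fun g a hg hM => ?_⟩
    have hb : ∀ b ∈ ball a (s / 2), ‖logDerivPoly g k b‖ ≤ A := fun b hb =>
      hA g b hg fun z hz => hM z (ball_half_subset_ball hb hz)
    have h1 := norm_deriv_le_of_forall_mem_ball (by linarith)
      (differentiable_logDerivPoly hg k).differentiableOn hb
    have h2 := hb a (mem_ball_self (by linarith))
    have h3 := hM a (mem_ball_self hs)
    rw [logDerivPoly_succ]
    refine (norm_add_le _ _).trans (add_le_add h1 ?_)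
    rw [norm_mul]
    exact mul_le_mul h3 h2 (norm_nonneg _) ((norm_nonneg _).trans h3)

lemma exists_norm_recipPoly_sub_one_le (k : ℕ) : ∀ s > 0, ∃ A > 0, ∀ (w : ℂ → ℂ) (a : ℂ) (ε : ℝ),
    ε ≤ 1 → DifferentiableOn ℂ w (ball a s) → (∀ z ∈ ball a s, ‖w z‖ ≤ ε) →
      ‖recipPoly w k a - 1‖ ≤ A * ε := by
  induction k with
  | zero =>
    refine fun s hs => ⟨1, one_pos, fun w a ε _ _ h => ?_⟩
    simpa [recipPoly] using (norm_nonneg _).trans (h a (mem_ball_self hs))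
  | succ k ih =>
    intro s hs
    obtain ⟨A, hA0, hA⟩ := ih (s / 2) (by linarith)
    refine ⟨A + A / (s / 2 / 2) + k * (1 / (s / 2)) * (1 + A), by positivity,
      fun w a ε hε hw hM => ?_⟩
    have hε0 : 0 ≤ ε := (norm_nonneg _).trans (hM a (mem_ball_self hs))
    have hb : ∀ b ∈ ball a (s / 2), ‖recipPoly w k b - 1‖ ≤ A * ε := fun b hb =>
      hA w b ε hε (hw.mono (ball_half_subset_ball hb))
        fun z hz => hM z (ball_half_subset_ball hb hz)
    have hQ : DifferentiableOn ℂ (fun z => recipPoly w k z - 1) (ball a (s / 2)) :=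
      ((differentiableOn_recipPoly isOpen_ball hw k).sub_const 1).mono
        (ball_subset_ball (by linarith))
    have h1 := norm_deriv_le_of_forall_mem_ball (by linarith) hQ hb
    rw [deriv_sub_const] at h1
    have h2 := hb a (mem_ball_self (by linarith))
    have h3 := hM a (mem_ball_self hs)
    have h4 := norm_deriv_le_of_forall_mem_ball hs hw hM
    have h5 : ‖recipPoly w k a‖ ≤ 1 + A := by
      calc ‖recipPoly w k a‖ = ‖1 + (recipPoly w k a - 1)‖ := by ring_nf
        _ ≤ ‖(1 : ℂ)‖ + ‖recipPoly w k a - 1‖ := norm_add_le _ _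
        _ ≤ 1 + A := by
          rw [norm_one]
          nlinarith
    have h6 : recipPoly w (k + 1) a - 1 = (recipPoly w k a - 1) +
        w a * deriv (recipPoly w k) a - k * deriv w a * recipPoly w k a := by
      rw [recipPoly_succ]
      ring
    rw [h6]
    have h7 : ‖w a * deriv (recipPoly w k) a‖ ≤ A / (s / 2 / 2) * ε := by
      rw [norm_mul]
      calc _ ≤ 1 * (A * ε / (s / 2 / 2)) :=
            mul_le_mul (h3.trans hε) h1 (norm_nonneg _) zero_le_one
        _ = _ := by ring
    have h8 : ‖k * deriv w a * recipPoly w k a‖ ≤ k * (1 / (s / 2)) * (1 + A) * ε := by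
      rw [norm_mul, norm_mul, Complex.norm_natCast]
      calc _ ≤ k * (ε / (s / 2)) * (1 + A) := by gcongr
        _ = _ := by ring
    calc _ ≤ ‖recipPoly w k a - 1‖ + ‖w a * deriv (recipPoly w k) a‖ +
          ‖k * deriv w a * recipPoly w k a‖ := norm_sub_le_of_le (norm_add_le _ _) le_rfl
      _ ≤ A * ε + A / (s / 2 / 2) * ε + k * (1 / (s / 2)) * (1 + A) * ε := by gcongr
      _ = _ := by ring

lemma logDerivPoly_eq_pow_mul_recipPoly {g : ℂ → ℂ} (hg : Differentiable ℂ g) (k : ℕ) {z : ℂ}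
    (hz : g z ≠ 0) :
    logDerivPoly g k z = g z ^ k * recipPoly (fun x => (g x)⁻¹) k z := by
  induction k generalizing z with
  | zero => simp [logDerivPoly, recipPoly]
  | succ k ih =>
    have hU : IsOpen {x | g x ≠ 0} := isOpen_ne_fun hg.continuous continuous_const
    have hw : DifferentiableOn ℂ (fun x => (g x)⁻¹) {x | g x ≠ 0} :=
      hg.differentiableOn.inv fun x hx => hx
    have hQ := ((differentiableOn_recipPoly hU hw k).differentiableAt
      (hU.mem_nhds hz)).hasDerivAt
    have he : logDerivPoly g k =ᶠ[𝓝 z] fun x => g x ^ k * recipPoly (fun x => (g x)⁻¹) k x := by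
      filter_upwards [hU.mem_nhds hz] with x hx using ih hx
    have hP := ((((hg z).hasDerivAt.pow k).mul hQ).congr_of_eventuallyEq he).deriv
    have hw' : deriv (fun x => (g x)⁻¹) z = -deriv g z / g z ^ 2 :=
      ((hg z).hasDerivAt.inv hz).deriv
    rw [logDerivPoly_succ, hP, ih hz, recipPoly_succ, hw']
    rcases k with _ | k
    · simp
      field_simp
      ring
    · simp only [Nat.add_sub_cancel, Pi.pow_apply]
      field_simp
      ring

/-- A zero-free holomorphic function has a holomorphic logarithm wherever its logarithmic
derivative has a primitive. -/
lemma eq_mul_exp_of_hasDerivAt {w L : ℂ → ℂ} {U : Set ℂ} (hU : IsOpen U) (hc : IsPreconnected U)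
    (hw : DifferentiableOn ℂ w U) (h0 : ∀ z ∈ U, w z ≠ 0)
    (hL : ∀ z ∈ U, HasDerivAt L (deriv w z / w z) z) {a z : ℂ} (ha : a ∈ U) (hLa : L a = 0)
    (hz : z ∈ U) : w z = w a * exp (L z) := by
  have hd : ∀ x ∈ U, HasDerivAt (fun y => w y * exp (-L y)) 0 x := by
    intro x hx
    have h1 := (hw.differentiableAt (hU.mem_nhds hx)).hasDerivAt.mul (hL x hx).neg.cexp
    convert! h1 using 1
    have := h0 x hx
    simp only [Pi.neg_apply]
    field_simp
    ring
  have h2 := hU.is_const_of_deriv_eq_zero hc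
    (fun x hx => (hd x hx).differentiableAt.differentiableWithinAt)
    (fun x hx => (hd x hx).deriv) hz ha
  simp only [hLa, neg_zero, exp_zero, mul_one] at h2
  rw [← h2, mul_assoc, ← exp_add, neg_add_cancel, exp_zero, mul_one]

/-- Harnack's inequality for `log ‖w‖`. -/
lemma add_mul_log_norm_le {w : ℂ → ℂ} {a z : ℂ} {r : ℝ} (hw : DifferentiableOn ℂ w (ball a r))
    (h0 : ∀ z ∈ ball a r, w z ≠ 0) (h1 : ∀ z ∈ ball a r, ‖w z‖ ≤ 1) (hz : z ∈ ball a r) :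
    (r + dist z a) * Real.log ‖w z‖ ≤ (r - dist z a) * Real.log ‖w a‖ := by
  have hzr : dist z a < r := hz
  have hr : 0 < r := dist_nonneg.trans_lt hzr
  have ha : a ∈ ball a r := mem_ball_self hr
  have hlog : ∀ x ∈ ball a r, Real.log ‖w x‖ ≤ 0 := fun x hx =>
    Real.log_nonpos (norm_nonneg _) (h1 x hx)
  rcases (hlog a ha).eq_or_lt with hl | hl
  · rw [hl, mul_zero]
    exact mul_nonpos_of_nonneg_of_nonpos (add_nonneg hr.le dist_nonneg) (hlog z hz)
  obtain ⟨L, hLa, hL⟩ := (((hw.deriv isOpen_ball).div hw h0).isExactOn_ball).with_val_at a 0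
  have hre : ∀ x ∈ ball a r, (L x).re = Real.log ‖w x‖ - Real.log ‖w a‖ := by
    intro x hx
    have := eq_mul_exp_of_hasDerivAt isOpen_ball (convex_ball a r).isPreconnected hw h0 hL ha hLa hx
    rw [this, norm_mul, Complex.norm_exp, Real.log_mul (norm_ne_zero_iff.2 (h0 a ha))
      (Real.exp_ne_zero _), Real.log_exp]
    ring
  set l := -Real.log ‖w a‖ with hl_def
  have hl0 : 0 < l := by linarith
  have hrel : ∀ x ∈ ball a r, (L x).re ≤ l := fun x hx => by
    rw [hre x hx]
    linarith [hlog x hx]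
  have hne : ∀ x ∈ ball a r, 2 * (l : ℂ) - L x ≠ 0 := by
    intro x hx h
    have := congrArg Complex.re h
    simp at this
    linarith [hrel x hx]
  have hle : ∀ x ∈ ball a r, ‖L x‖ ≤ ‖2 * (l : ℂ) - L x‖ := by
    intro x hx
    rw [← sq_le_sq₀ (by positivity) (by positivity), Complex.sq_norm, Complex.sq_norm,
      normSq_apply, normSq_apply]
    simp
    nlinarith [hrel x hx]
  have hLd : DifferentiableOn ℂ L (ball a r) := fun x hx =>
    (hL x hx).differentiableAt.differentiableWithinAt
  have hS := dist_le_div_mul_dist_of_mapsTo_ball (f := fun x => L x / (2 * (l : ℂ) - L x))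
    (R₂ := 1) (hLd.div (hLd.const_sub _) hne) (fun x hx => by
      simpa [hLa] using div_le_one_of_le₀ (hle x hx) (norm_nonneg _)) hz
  simp only [hLa, zero_div, dist_zero_right, norm_div] at hS
  rw [div_le_iff₀ (norm_pos_iff.2 (hne z hz))] at hS
  set t := 1 / r * dist z a with ht
  have ht0 : 0 ≤ t := by positivity
  have ht1 : t < 1 := by
    rw [ht, one_div, inv_mul_lt_iff₀ hr]
    linarith
  have hx : (L z).re ≤ t * (2 * l - (L z).re) := by
    refine le_of_sq_le_sq ?_ (mul_nonneg ht0 (by linarith [hrel z hz]))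
    have := pow_le_pow_left₀ (norm_nonneg _) hS 2
    rw [mul_pow, Complex.sq_norm, Complex.sq_norm, normSq_apply, normSq_apply] at this
    simp at this
    nlinarith [mul_nonneg (sub_nonneg.2 (pow_le_one₀ ht0 ht1.le (n := 2))) (sq_nonneg (L z).im)]
  have htr : t * r = dist z a := by rw [ht]; field_simp
  rw [hre z hz] at hx
  have := mul_le_mul_of_nonneg_right hx hr.le
  rw [← htr]
  nlinarith

lemma abs_inv_one_add_sq_sub_le {g : ℂ → ℂ} (hg : Differentiable ℂ g) {C : ℝ} {s : Set ℂ}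
    (hs : Convex ℝ s) (h : ∀ z ∈ s, ‖deriv g z‖ ≤ C * (1 + ‖g z‖ ^ 2)) {x y : ℂ}
    (hx : x ∈ s) (hy : y ∈ s) :
    |(1 + ‖g y‖ ^ 2)⁻¹ - (1 + ‖g x‖ ^ 2)⁻¹| ≤ C * dist y x := by
  rw [← Real.norm_eq_abs, dist_eq_norm]
  have hd : ∀ z, HasFDerivAt (𝕜 := ℝ) (fun z => (1 + ‖g z‖ ^ 2)⁻¹) (-((1 + ‖g z‖ ^ 2) ^ 2)⁻¹ •
      (2 • (innerSL ℝ (g z)).comp ((fderiv ℂ g z).restrictScalars ℝ))) z := by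
    intro z
    have h1 := ((hg z).hasFDerivAt.restrictScalars ℝ).norm_sq.const_add 1
    exact (hasDerivAt_inv (by positivity)).comp_hasFDerivAt z h1
  refine hs.norm_image_sub_le_of_norm_hasFDerivWithin_le
    (fun z _ => (hd z).hasFDerivWithinAt) (fun z hz => ?_) hx hy
  have hC : 0 ≤ C := by
    by_contra hC
    have := (norm_nonneg _).trans (h z hz)
    nlinarith [sq_nonneg ‖g z‖]
  refine ContinuousLinearMap.opNorm_le_bound _ hC fun v => ?_
  simp only [smul_apply, ContinuousLinearMap.comp_apply,
    ContinuousLinearMap.coe_restrictScalars', fderiv_eq_smul_deriv, innerSL_apply_apply,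
    smul_eq_mul, nsmul_eq_mul, Nat.cast_ofNat, norm_mul, norm_neg, norm_inv, norm_pow]
  have h1 : ‖inner ℝ (g z) (v * deriv g z)‖ ≤ ‖g z‖ * (‖v‖ * ‖deriv g z‖) := by
    simpa using norm_inner_le_norm (𝕜 := ℝ) (g z) (v * deriv g z)
  have h2 : ‖(1 + ‖g z‖ ^ 2 : ℝ)‖ = 1 + ‖g z‖ ^ 2 := Real.norm_of_nonneg (by positivity)
  rw [h2, Real.norm_ofNat, inv_mul_le_iff₀ (by positivity)]
  have h3 := h z hz
  calc 2 * ‖inner ℝ (g z) (v * deriv g z)‖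
      ≤ 2 * (‖g z‖ * (‖v‖ * (C * (1 + ‖g z‖ ^ 2)))) := by gcongr; exact h1.trans (by gcongr)
    _ = (2 * ‖g z‖) * (‖v‖ * (C * (1 + ‖g z‖ ^ 2))) := by ring
    _ ≤ (1 + ‖g z‖ ^ 2) * (‖v‖ * (C * (1 + ‖g z‖ ^ 2))) := by
      gcongr
      nlinarith [sq_nonneg (‖g z‖ - 1)]
    _ = (1 + ‖g z‖ ^ 2) ^ 2 * (C * ‖v‖) := by ring

lemma norm_le_norm_pow_three {g : ℂ → ℂ} (hg : Differentiable ℂ g) {C δ : ℝ} {a z : ℂ}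
    (hC : 0 ≤ C) (hCδ : C * δ ≤ 1 / 4) (h : ∀ z ∈ ball a δ, ‖deriv g z‖ ≤ C * (1 + ‖g z‖ ^ 2))
    (ha : 2 ≤ ‖g a‖) (hz : z ∈ ball a (δ / 2)) : 1 ≤ ‖g z‖ ∧ ‖g a‖ ≤ ‖g z‖ ^ 3 := by
  have hzδ : dist z a < δ / 2 := hz
  have hδ : 0 < δ := by linarith [dist_nonneg (x := z) (y := a)]
  have hone : ∀ x ∈ ball a δ, 1 ≤ ‖g x‖ := by
    intro x hx
    have h1 := abs_inv_one_add_sq_sub_le hg (convex_ball a δ) h (mem_ball_self hδ) hx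
    have h2 : (1 + ‖g a‖ ^ 2)⁻¹ ≤ 1 / 4 := by
      rw [inv_le_comm₀ (by positivity) (by norm_num)]
      nlinarith
    have h3 : C * dist x a ≤ 1 / 4 :=
      (mul_le_mul_of_nonneg_left (le_of_lt hx) hC).trans hCδ
    have h4 := le_abs_self ((1 + ‖g x‖ ^ 2)⁻¹ - (1 + ‖g a‖ ^ 2)⁻¹)
    replace h4 : (1 + ‖g x‖ ^ 2)⁻¹ ≤ 1 / 2 := by linarith
    rw [inv_le_comm₀ (by positivity) (by norm_num)] at h4
    by_contra! hlt
    nlinarith [norm_nonneg (g x)]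
  have hzb : z ∈ ball a δ := by
    rw [mem_ball]
    linarith
  have hne : ∀ x ∈ ball a δ, g x ≠ 0 := fun x hx =>
    norm_pos_iff.1 (one_pos.trans_le (hone x hx))
  have hH := add_mul_log_norm_le (w := fun x => (g x)⁻¹) (hg.differentiableOn.inv hne)
    (fun x hx => inv_ne_zero (hne x hx))
    (fun x hx => by rw [norm_inv]; exact inv_le_one_of_one_le₀ (hone x hx)) hzb
  simp only [norm_inv, Real.log_inv] at hH
  refine ⟨hone z hzb, ?_⟩
  have hla : 0 ≤ Real.log ‖g a‖ := Real.log_nonneg (by linarith)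
  have hlz : 0 ≤ Real.log ‖g z‖ := Real.log_nonneg (hone z hzb)
  have : Real.log ‖g a‖ ≤ 3 * Real.log ‖g z‖ := by
    have h1 : δ / 2 * Real.log ‖g a‖ ≤ (δ - dist z a) * Real.log ‖g a‖ := by gcongr; linarith
    have h2 : (δ + dist z a) * Real.log ‖g z‖ ≤ (3 * δ / 2) * Real.log ‖g z‖ := by
      gcongr; linarith
    have h3 : δ / 2 * Real.log ‖g a‖ ≤ δ / 2 * (3 * Real.log ‖g z‖) := by linarith
    exact le_of_mul_le_mul_left h3 (by linarith)
  rw [← Real.log_le_log_iff (by linarith) (pow_pos (one_pos.trans_le (hone z hzb)) 3),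
    Real.log_pow]
  exact_mod_cast this

lemma norm_inv_le_of_one_le_mul {g : ℂ → ℂ} (hg : Differentiable ℂ g) {C δ ε : ℝ} {a z : ℂ}
    (hC : 0 ≤ C) (hCδ : C * δ ≤ 1 / 4) (h : ∀ z ∈ ball a δ, ‖deriv g z‖ ≤ C * (1 + ‖g z‖ ^ 2))
    (ha : 2 ≤ ‖g a‖) (hε : 0 < ε) (hεa : 1 ≤ ε ^ 3 * ‖g a‖) (hz : z ∈ ball a (δ / 2)) :
    g z ≠ 0 ∧ ‖(g z)⁻¹‖ ≤ ε := by
  obtain ⟨h1, h3⟩ := norm_le_norm_pow_three hg hC hCδ h ha hz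
  have h0 : 0 < ‖g z‖ := one_pos.trans_le h1
  refine ⟨norm_pos_iff.1 h0, ?_⟩
  rw [norm_inv, inv_le_iff_one_le_mul₀ h0]
  have : 1 ≤ (ε * ‖g z‖) ^ 3 := by
    rw [mul_pow]
    exact hεa.trans (by gcongr)
  exact (one_le_pow_iff_of_nonneg (by positivity) (by norm_num)).1 this

/-- Hurwitz's theorem for locally uniform limits of zero-free entire functions. -/
lemma eq_zero_or_ne_zero_of_tendstoLocallyUniformlyOn {ι : Type*} {l : Filter ι} [l.NeBot]
    {F : ι → ℂ → ℂ} {f : ℂ → ℂ} (hF : ∀ n, Differentiable ℂ (F n)) (h0 : ∀ n z, F n z ≠ 0)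
    (h : TendstoLocallyUniformlyOn F f l univ) : (∀ z, f z = 0) ∨ ∀ z, f z ≠ 0 := by
  have hf : Differentiable ℂ f := differentiableOn_univ.1
    (h.differentiableOn (.of_forall fun n => (hF n).differentiableOn) isOpen_univ)
  by_contra! hcon
  obtain ⟨⟨b, hb⟩, a, ha⟩ := hcon
  have han : AnalyticOnNhd ℂ f univ := fun z _ => hf.analyticAt z
  rcases (hf.analyticAt a).eventually_eq_zero_or_eventually_ne_zero with he | he
  · exact hb (han.eqOn_zero_of_preconnected_of_eventuallyEq_zero isPreconnected_univ
      (mem_univ a) he (mem_univ b))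
  rw [eventually_nhdsWithin_iff, Metric.eventually_nhds_iff_ball] at he
  obtain ⟨r, hr, hne⟩ := he
  have hs : ∀ z ∈ sphere a (r / 2), f z ≠ 0 := fun z hz =>
    hne z (by rw [mem_ball, mem_sphere.1 hz]; linarith)
      (by rintro rfl; simp at hz; linarith)
  obtain ⟨y, hy, hmin⟩ := (isCompact_sphere a (r / 2)).exists_isMinOn
    (NormedSpace.sphere_nonempty.2 (by linarith)) hf.continuous.norm.continuousOn
  have hm : 0 < ‖f y‖ := norm_pos_iff.2 (hs y hy)
  have hu := (tendstoLocallyUniformlyOn_iff_forall_isCompact isOpen_univ).1 h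
    (closedBall a (r / 2)) (subset_univ _) (isCompact_closedBall _ _)
  obtain ⟨n, hn⟩ := (Metric.tendstoUniformlyOn_iff.1 hu (‖f y‖ / 2) (by linarith)).exists
  have hFa : ‖F n a‖ < ‖f y‖ / 2 := by
    simpa [ha] using hn a (mem_closedBall_self (by linarith))
  have hFs : ∀ z ∈ sphere a (r / 2), ‖f y‖ / 2 ≤ ‖F n z‖ := by
    intro z hz
    have h1 := hn z (sphere_subset_closedBall hz)
    have h2 : ‖f y‖ ≤ ‖f z‖ := hmin hz
    rw [dist_eq_norm] at h1
    linarith [norm_sub_norm_le (f z) (F n z)]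
  have hd : DiffContOnCl ℂ (fun z => (F n z)⁻¹) (ball a (r / 2)) :=
    ((hF n).inv (h0 n)).diffContOnCl
  have := Complex.norm_le_of_forall_mem_frontier_norm_le isBounded_ball hd
    (C := (‖f y‖ / 2)⁻¹) (fun z hz => by
      rw [frontier_ball _ (by linarith)] at hz
      rw [norm_inv]
      exact inv_anti₀ (by linarith) (hFs z hz)) (subset_closure (mem_ball_self (by linarith)))
  rw [norm_inv, inv_le_inv₀ (norm_pos_iff.2 (h0 n a)) (by linarith)] at this
  linarith

/-- A zero-free entire function of exponential type is the exponential of an affine map. -/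
lemma eq_exp_affine_of_norm_le {F : ℂ → ℂ} (hF : Differentiable ℂ F) (h0 : ∀ z, F z ≠ 0)
    {A B : ℝ} (h : ∀ z, ‖F z‖ ≤ Real.exp (A * ‖z‖ + B)) :
    ∃ α β : ℂ, ∀ z, F z = exp (α * z + β) := by
  obtain ⟨L, hL0, hL⟩ := (((differentiable_deriv_of_entire hF).div hF h0).isExactOn_univ).with_val_at
    0 0
  have hLd : Differentiable ℂ L := fun z => (hL z (mem_univ z)).differentiableAt
  have hexp : ∀ z, F z = F 0 * exp (L z) := fun z =>
    eq_mul_exp_of_hasDerivAt isOpen_univ isPreconnected_univ hF.differentiableOn (fun z _ => h0 z)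
      hL (mem_univ 0) hL0 (mem_univ z)
  set K := |A| + |B - Real.log ‖F 0‖| + 1 with hK
  have hK0 : 0 < K := by positivity
  have hre : ∀ z, (L z).re ≤ K * (‖z‖ + 1) := by
    intro z
    have h1 := h z
    rw [hexp z, norm_mul, Complex.norm_exp,
      ← Real.log_le_log_iff (mul_pos (norm_pos_iff.2 (h0 0)) (Real.exp_pos _)) (Real.exp_pos _),
      Real.log_mul (norm_ne_zero_iff.2 (h0 0)) (Real.exp_ne_zero _), Real.log_exp,
      Real.log_exp] at h1
    have h2 := le_abs_self A
    have h3 := le_abs_self (B - Real.log ‖F 0‖)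
    nlinarith [norm_nonneg z, abs_nonneg A, abs_nonneg (B - Real.log ‖F 0‖),
      mul_le_mul_of_nonneg_right h2 (norm_nonneg z),
      mul_nonneg (abs_nonneg (B - Real.log ‖F 0‖)) (norm_nonneg z)]
  have hnorm : ∀ R ≥ 1, ∀ z, ‖z‖ ≤ R → ‖L z‖ ≤ 6 * K * R := by
    intro R hR z hz
    have h1 := borelCaratheodory_zero (f := L) (M := K * (2 * R + 1)) (R := 2 * R) (z := z)
      (by positivity) hLd.differentiableOn (fun x hx => (hre x).trans (by
        rw [mem_ball_zero_iff] at hx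
        gcongr)) (by linarith) (by rw [mem_ball_zero_iff]; linarith) hL0
    refine h1.trans ?_
    rw [div_le_iff₀ (by linarith)]
    have h2 : 2 * (K * (2 * R + 1)) * ‖z‖ ≤ 6 * K * R * R := by
      calc _ ≤ 2 * (K * (2 * R + R)) * R := by gcongr
        _ = _ := by ring
    exact h2.trans (mul_le_mul_of_nonneg_left (by linarith) (by positivity))
  have hder : ∀ z, ‖deriv L z‖ ≤ 24 * K := by
    intro z
    have h1 := norm_deriv_le_of_forall_mem_ball (F := L) (a := z) (r := ‖z‖ + 1)
      (C := 6 * K * (2 * (‖z‖ + 1))) (by positivity) hLd.differentiableOn (fun x hx =>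
        hnorm _ (by linarith [norm_nonneg z]) x (by
          rw [mem_ball, dist_eq_norm] at hx
          linarith [norm_le_norm_add_norm_sub' x z, norm_nonneg z]))
    refine h1.trans (le_of_eq ?_)
    have : ‖z‖ + 1 ≠ 0 := by positivity
    field_simp
    ring
  obtain ⟨α, hα⟩ := (differentiable_deriv_of_entire hLd).exists_const_forall_eq_of_bounded
    (isBounded_iff_forall_norm_le.2 ⟨24 * K, by rintro _ ⟨z, rfl⟩; exact hder z⟩)
  have hlin : ∀ z, L z = α * z := by
    intro z
    have hd : ∀ x, HasDerivAt (fun y => L y - α * y) 0 x := by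
      intro x
      convert! (hLd x).hasDerivAt.sub ((hasDerivAt_id x).const_mul α) using 1
      simp [hα x]
    have := is_const_of_deriv_eq_zero (fun x => (hd x).differentiableAt)
      (fun x => (hd x).deriv) z 0
    simpa [hL0, sub_eq_zero] using this
  refine ⟨α, Complex.log (F 0), fun z => ?_⟩
  rw [hexp z, hlin z, exp_add, exp_log (h0 0), mul_comm]

/-- An entire function with bounded spherical derivative is of exponential type. -/
lemma exists_norm_le_exp_of_norm_deriv_le {g : ℂ → ℂ} (hg : Differentiable ℂ g) {C : ℝ}
    (hC : 0 < C) (h : ∀ z, ‖deriv g z‖ ≤ C * (1 + ‖g z‖ ^ 2)) :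
    ∃ A B : ℝ, 0 ≤ A ∧ 0 ≤ B ∧ ∀ z, ‖g z‖ ≤ Real.exp (A * ‖z‖ + B) := by
  set K := {z | ‖g z‖ ≤ 1} with hK
  rcases K.eq_empty_or_nonempty with hKe | ⟨z₀, hz₀⟩
  · have h1 : ∀ z, 1 < ‖g z‖ := fun z => by
      by_contra! hz
      exact (hKe ▸ (show z ∈ K from hz) : z ∈ (∅ : Set ℂ))
    obtain ⟨c, hc⟩ := (hg.inv fun z => norm_pos_iff.1
      (one_pos.trans (h1 z))).exists_const_forall_eq_of_bounded
      (isBounded_iff_forall_norm_le.2 ⟨1, by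
        rintro _ ⟨z, rfl⟩
        simpa using inv_le_one_of_one_le₀ (h1 z).le⟩)
    refine ⟨0, ‖c⁻¹‖, le_rfl, norm_nonneg _, fun z => ?_⟩
    have : g z = c⁻¹ := by rw [← hc z]; simp
    rw [this]
    linarith [Real.add_one_le_exp (0 * ‖z‖ + ‖c⁻¹‖)]
  have hKc : IsClosed K := isClosed_le hg.continuous.norm continuous_const
  refine ⟨6 * C, 6 * C * ‖z₀‖ + 1, by positivity, by positivity, fun z => ?_⟩
  rcases le_or_gt ‖g z‖ (Real.exp 1) with hz | hz
  · refine hz.trans (Real.exp_le_exp.2 ?_)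
    have : 0 ≤ 6 * C * ‖z‖ := by positivity
    have : 0 ≤ 6 * C * ‖z₀‖ := by positivity
    linarith
  have hz0 : 0 < ‖g z‖ := (Real.exp_pos 1).trans hz
  set l := Real.log ‖g z‖ with hl
  have hl1 : 1 < l := (Real.lt_log_iff_exp_lt hz0).2 hz
  obtain ⟨y, hyK, hy⟩ := hKc.exists_infDist_eq_dist ⟨z₀, hz₀⟩ z
  set r := dist z y with hr
  have hr0 : 0 < r := by
    refine dist_pos.2 fun hzy => ?_
    have : ‖g z‖ ≤ 1 := by rw [hzy]; exact hyK
    linarith [Real.add_one_le_exp 1]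
  have hone : ∀ x ∈ ball z r, 1 < ‖g x‖ := fun x hx => by
    by_contra! hx1
    have := infDist_le_dist_of_mem (x := z) (show x ∈ K from hx1)
    rw [hy, dist_comm] at this
    exact (mem_ball.1 hx).not_ge this
  have hrle : r ≤ ‖z‖ + ‖z₀‖ := by
    rw [← hy]
    exact (infDist_le_dist_of_mem hz₀).trans (dist_le_norm_add_norm _ _)
  set t := 1 - l⁻¹ with ht
  have hlinv : l⁻¹ < 1 := inv_lt_one_of_one_lt₀ hl1
  have hlpos : 0 < l⁻¹ := by positivity
  set x := z + (t : ℂ) * (y - z) with hx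
  have hnt : ‖(t : ℂ)‖ = t := by rw [norm_real, Real.norm_of_nonneg (by linarith)]
  have hxz : dist x z = t * r := by
    rw [dist_eq_norm, hx, add_sub_cancel_left, norm_mul, hnt, hr, dist_comm, dist_eq_norm]
  have hyx : dist y x = l⁻¹ * r := by
    have : y - x = ((l⁻¹ : ℝ) : ℂ) * (y - z) := by
      rw [hx, ht]; push_cast; ring
    rw [dist_eq_norm, this, norm_mul, norm_real, Real.norm_of_nonneg hlpos.le, hr, dist_comm,
      dist_eq_norm]
  have hxb : x ∈ ball z r := by
    rw [mem_ball, hxz]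
    nlinarith
  have hne : ∀ x ∈ ball z r, g x ≠ 0 := fun x hx => norm_pos_iff.1 (one_pos.trans (hone x hx))
  have hH := add_mul_log_norm_le (w := fun x => (g x)⁻¹) (hg.differentiableOn.inv hne)
    (fun x hx => inv_ne_zero (hne x hx))
    (fun x hx => by rw [norm_inv]; exact inv_le_one_of_one_le₀ (hone x hx).le) hxb
  simp only [norm_inv, Real.log_inv, hxz] at hH
  have hlog : 0 < Real.log ‖g x‖ := Real.log_pos (hone x hxb)
  have hhalf : 1 ≤ 2 * Real.log ‖g x‖ := by
    have h1 : (r - t * r) * l = r := by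
      rw [ht]; field_simp; ring
    have h2 : (r + t * r) * Real.log ‖g x‖ ≤ 2 * r * Real.log ‖g x‖ := by
      gcongr
      nlinarith
    have h3 : r * 1 ≤ r * (2 * Real.log ‖g x‖) := by linarith
    exact le_of_mul_le_mul_left h3 hr0
  have hsq : 2 ≤ ‖g x‖ ^ 2 := by
    have h1 : 1 ≤ Real.log (‖g x‖ ^ 2) := by rw [Real.log_pow]; exact_mod_cast hhalf
    rw [Real.le_log_iff_exp_le (by have := one_pos.trans (hone x hxb); positivity)] at h1
    linarith [Real.add_one_le_exp 1]
  have hLip := abs_inv_one_add_sq_sub_le hg convex_univ (fun z _ => h z) (mem_univ x) (mem_univ y)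
  have hcx : (1 + ‖g x‖ ^ 2)⁻¹ ≤ 1 / 3 := by
    rw [inv_le_comm₀ (by positivity) (by norm_num)]
    linarith
  have hcy : 1 / 2 ≤ (1 + ‖g y‖ ^ 2)⁻¹ := by
    rw [le_inv_comm₀ (by norm_num) (by positivity)]
    have : ‖g y‖ ^ 2 ≤ 1 := pow_le_one₀ (norm_nonneg _) hyK
    linarith
  have h6 := le_abs_self ((1 + ‖g y‖ ^ 2)⁻¹ - (1 + ‖g x‖ ^ 2)⁻¹)
  rw [hyx] at hLip
  have h7 : l ≤ 6 * C * r := by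
    have : 1 / 6 ≤ C * (l⁻¹ * r) := by linarith
    calc l = l * (6 * (1 / 6)) := by ring
      _ ≤ l * (6 * (C * (l⁻¹ * r))) := by gcongr
      _ = 6 * C * r := by field_simp
  rw [← Real.exp_log hz0]
  refine Real.exp_le_exp.2 ?_
  have : 6 * C * r ≤ 6 * C * (‖z‖ + ‖z₀‖) := by gcongr
  linarith

lemma exists_norm_logDerivPoly_le_exp {g : ℂ → ℂ} (hg : Differentiable ℂ g)
    (h : ∃ A B : ℝ, 0 ≤ A ∧ 0 ≤ B ∧ ∀ z, ‖g z‖ ≤ Real.exp (A * ‖z‖ + B)) (k : ℕ) :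
    ∃ A B : ℝ, 0 ≤ A ∧ 0 ≤ B ∧ ∀ z, ‖logDerivPoly g k z‖ ≤ Real.exp (A * ‖z‖ + B) := by
  induction k with
  | zero => exact ⟨0, 0, le_rfl, le_rfl, fun z => by simp [logDerivPoly]⟩
  | succ k ih =>
    obtain ⟨A, B, hA, hB, hAB⟩ := h
    obtain ⟨A', B', hA', hB', hAB'⟩ := ih
    refine ⟨A + A', 2 * A' + B + B' + 1, by positivity, by positivity, fun z => ?_⟩
    have h1 := norm_deriv_le_of_forall_mem_ball (F := logDerivPoly g k) (a := z) (r := 2)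
      (C := Real.exp (A' * (‖z‖ + 2) + B')) (by norm_num)
      (differentiable_logDerivPoly hg k).differentiableOn (fun x hx => (hAB' x).trans (by
        rw [mem_ball, dist_eq_norm] at hx
        have : ‖x‖ ≤ ‖z‖ + 2 := by linarith [norm_le_norm_add_norm_sub' x z]
        gcongr))
    rw [div_self (by norm_num : (2 : ℝ) ≠ 0), div_one] at h1
    have hz := norm_nonneg z
    calc ‖logDerivPoly g (k + 1) z‖ ≤ ‖deriv (logDerivPoly g k) z‖ + ‖g z‖ * ‖logDerivPoly g k z‖ := by
          rw [logDerivPoly_succ, ← norm_mul]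
          exact norm_add_le _ _
      _ ≤ Real.exp (A' * (‖z‖ + 2) + B') + Real.exp (A * ‖z‖ + B) * Real.exp (A' * ‖z‖ + B') := by
          gcongr
          exacts [hAB z, hAB' z]
      _ ≤ Real.exp ((A + A') * ‖z‖ + (2 * A' + B + B')) +
          Real.exp ((A + A') * ‖z‖ + (2 * A' + B + B')) := by
          rw [← Real.exp_add]
          have := mul_nonneg hA hz
          exact add_le_add (Real.exp_le_exp.2 (by linarith)) (Real.exp_le_exp.2 (by linarith))
      _ ≤ Real.exp ((A + A') * ‖z‖ + (2 * A' + B + B')) * Real.exp 1 := by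
          rw [← two_mul, mul_comm]
          gcongr
          linarith [Real.add_one_le_exp 1]
      _ = _ := by rw [← Real.exp_add]; ring_nf

lemma norm_le_max_of_mem_ball {g : ℂ → ℂ} (hg : Differentiable ℂ g) {C δ : ℝ} {a z : ℂ}
    (hC : 0 ≤ C) (hCδ : C * δ ≤ 1 / 4) (h : ∀ x ∈ ball z δ, ‖deriv g x‖ ≤ C * (1 + ‖g x‖ ^ 2))
    (hz : z ∈ ball a (δ / 2)) : ‖g z‖ ≤ max 2 (‖g a‖ ^ 3) := by
  rcases le_total ‖g z‖ 2 with h2 | h2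
  · exact h2.trans (le_max_left _ _)
  · exact (norm_le_norm_pow_three hg hC hCδ h h2 (mem_ball_comm.1 hz)).2.trans (le_max_right _ _)

lemma exists_norm_le_of_norm_logDerivPoly_le {k : ℕ} (hk : k ≠ 0) {C δ : ℝ} (hC : 0 ≤ C)
    (hδ : 0 < δ) (hCδ : C * δ ≤ 1 / 4) (B : ℝ) :
    ∃ M : ℝ, ∀ g a, Differentiable ℂ g → (∀ z ∈ ball a δ, ‖deriv g z‖ ≤ C * (1 + ‖g z‖ ^ 2)) →
      ‖logDerivPoly g k a‖ ≤ B → ‖g a‖ ≤ M := by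
  obtain ⟨A, hA, hQ⟩ := exists_norm_recipPoly_sub_one_le k (δ / 2) (by linarith)
  set ε := min 1 (2 * A)⁻¹ with hε
  have hε0 : 0 < ε := by positivity
  refine ⟨max (max 2 (ε ^ 3)⁻¹) (2 * B), fun g a hg h hP => ?_⟩
  by_contra! hlt
  obtain ⟨hlt, hB⟩ := max_lt_iff.1 hlt
  obtain ⟨h2, hε3⟩ := max_lt_iff.1 hlt
  have hw : ∀ z ∈ ball a (δ / 2), g z ≠ 0 ∧ ‖(g z)⁻¹‖ ≤ ε := fun z hz =>
    norm_inv_le_of_one_le_mul hg hC hCδ h h2.le hε0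
      (by rw [← inv_le_iff_one_le_mul₀' (by positivity)]; exact hε3.le) hz
  have hQa := hQ (fun x => (g x)⁻¹) a ε (min_le_left _ _)
    (hg.differentiableOn.inv fun x hx => (hw x hx).1) (fun z hz => (hw z hz).2)
  have hAε : A * ε ≤ 1 / 2 := by
    calc A * ε ≤ A * (2 * A)⁻¹ := by gcongr; exact min_le_right _ _
      _ = 1 / 2 := by field_simp
  have hQ2 : 1 / 2 ≤ ‖recipPoly (fun x => (g x)⁻¹) k a‖ := by
    have := norm_sub_norm_le (1 : ℂ) (1 - recipPoly (fun x => (g x)⁻¹) k a)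
    rw [norm_one, sub_sub_cancel, norm_sub_rev] at this
    linarith
  rw [logDerivPoly_eq_pow_mul_recipPoly hg k (hw a (mem_ball_self (by linarith))).1, norm_mul,
    norm_pow] at hP
  have hpow : ‖g a‖ ≤ ‖g a‖ ^ k := le_self_pow₀ (by linarith) hk
  nlinarith

lemma exists_norm_logDerivPoly_le_of_norm_le (k : ℕ) {C : ℝ} (hC : 0 < C) (M : ℝ) :
    ∃ B : ℝ, ∀ g a, Differentiable ℂ g → (∀ z, ‖deriv g z‖ ≤ C * (1 + ‖g z‖ ^ 2)) →
      ‖g a‖ ≤ M → ‖logDerivPoly g k a‖ ≤ B := by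
  obtain ⟨B, hB⟩ := exists_norm_logDerivPoly_le k ((4 * C)⁻¹ / 2) (by positivity) (max 2 (M ^ 3))
  refine ⟨B, fun g a hg h hM => hB g a hg fun z hz => ?_⟩
  exact (norm_le_max_of_mem_ball hg hC.le (by field_simp; norm_num) (fun x _ => h x) hz).trans
    (by gcongr)

/-- Liouville's theorem for differential polynomials of functions with bounded spherical
derivative. -/
lemma deriv_eq_zero_of_norm_logDerivPoly_le {g : ℂ → ℂ} (hg : Differentiable ℂ g) {C : ℝ}
    (hC : 0 < C) (h : ∀ z, ‖deriv g z‖ ≤ C * (1 + ‖g z‖ ^ 2)) {k : ℕ} (hk : k ≠ 0) {B : ℝ}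
    (hP : ∀ z, ‖logDerivPoly g k z‖ ≤ B) (z : ℂ) : deriv g z = 0 := by
  obtain ⟨M, hM⟩ := exists_norm_le_of_norm_logDerivPoly_le hk hC.le (δ := (4 * C)⁻¹)
    (by positivity) (by field_simp; norm_num) B
  obtain ⟨c, hc⟩ := hg.exists_const_forall_eq_of_bounded (isBounded_iff_forall_norm_le.2
    ⟨M, by rintro _ ⟨x, rfl⟩; exact hM g x hg (fun x _ => h x) (hP x)⟩)
  rw [show g = fun _ => c from funext hc]
  simp

lemma tendsto_deriv_of_norm_le_of_re_le {F : ℂ → ℂ} (hF : Differentiable ℂ F) {X M : ℝ}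
    (h : ∀ z : ℂ, z.re ≤ X → ‖F z‖ ≤ M) : Tendsto (deriv F) (comap re atBot) (𝓝 0) := by
  have hM : 0 ≤ M := (norm_nonneg _).trans (h X (by simp))
  rw [Metric.tendsto_nhds]
  intro ε hε
  set R := 2 * (M + 1) / ε with hR
  have hR0 : 0 < R := by positivity
  filter_upwards [preimage_mem_comap (Iic_mem_atBot (X - R))] with z hz
  have hz : z.re ≤ X - R := hz
  have := norm_deriv_le_of_forall_mem_ball (F := F) (a := z) hR0 hF.differentiableOn
    (C := M) (fun x hx => h x (by
      have h1 := (abs_re_le_norm (x - z)).trans_lt (by rwa [mem_ball, dist_eq_norm] at hx)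
      rw [sub_re, abs_lt] at h1
      linarith))
  rw [dist_zero_right]
  refine this.trans_lt ?_
  rw [hR, div_lt_iff₀ (by positivity)]
  field_simp
  linarith

lemma tendsto_logDerivPoly_sub_pow {g : ℂ → ℂ} (hg : Differentiable ℂ g) {X M : ℝ}
    (h : ∀ z : ℂ, z.re ≤ X → ‖g z‖ ≤ M) (k : ℕ) :
    Tendsto (fun z => logDerivPoly g k z - g z ^ k) (comap re atBot) (𝓝 0) := by
  induction k with
  | zero => simpa [logDerivPoly] using tendsto_const_nhds
  | succ k ih =>
    obtain ⟨A, hA⟩ := exists_norm_logDerivPoly_le k 1 one_pos M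
    have h1 := tendsto_deriv_of_norm_le_of_re_le (differentiable_logDerivPoly hg k) (X := X - 1)
      (M := A) (fun z hz => hA g z hg fun x hx => h x (by
        have h1 := (abs_re_le_norm (x - z)).trans_lt (by rwa [mem_ball, dist_eq_norm] at hx)
        rw [sub_re, abs_lt] at h1
        linarith))
    have h2 : Tendsto (fun z => g z * (logDerivPoly g k z - g z ^ k)) (comap re atBot) (𝓝 0) :=
      isBoundedUnder_le_mul_tendsto_zero ⟨M, by
        rw [eventually_map]
        filter_upwards [preimage_mem_comap (Iic_mem_atBot X)] with z hz using h z hz⟩ ih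
    convert! h1.add h2 using 2
    · rw [logDerivPoly_succ]; ring
    · simp

section ExponentialDifferentialPolynomial

variable {g : ℂ → ℂ} {C : ℝ} {k : ℕ} {κ : ℂ}

lemma exists_norm_le_of_re_le (hg : Differentiable ℂ g) (hC : 0 < C)
    (h : ∀ z, ‖deriv g z‖ ≤ C * (1 + ‖g z‖ ^ 2)) (hk : k ≠ 0)
    (hP : ∀ z, logDerivPoly g k z = κ * exp z) (X : ℝ) :
    ∃ M : ℝ, ∀ z : ℂ, z.re ≤ X → ‖g z‖ ≤ M := by
  obtain ⟨M, hM⟩ := exists_norm_le_of_norm_logDerivPoly_le hk hC.le (δ := (4 * C)⁻¹)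
    (by positivity) (by field_simp; norm_num) (‖κ‖ * Real.exp X)
  refine ⟨M, fun z hz => hM g z hg (fun x _ => h x) ?_⟩
  rw [hP, norm_mul, norm_exp]
  gcongr

lemma tendsto_zero_of_logDerivPoly_eq (hg : Differentiable ℂ g) (hC : 0 < C)
    (h : ∀ z, ‖deriv g z‖ ≤ C * (1 + ‖g z‖ ^ 2)) (hk : k ≠ 0)
    (hP : ∀ z, logDerivPoly g k z = κ * exp z) : Tendsto g (comap re atBot) (𝓝 0) := by
  obtain ⟨M, hM⟩ := exists_norm_le_of_re_le hg hC h hk hP 0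
  have h1 := tendsto_logDerivPoly_sub_pow hg hM k
  have h2 : Tendsto (logDerivPoly g k) (comap re atBot) (𝓝 0) := by
    rw [show logDerivPoly g k = fun z => κ * exp z from funext hP]
    simpa using (tendsto_exp_comap_re_atBot).const_mul κ
  have h3 : Tendsto (fun z => g z ^ k) (comap re atBot) (𝓝 0) := by simpa using h2.sub h1
  rw [tendsto_zero_iff_norm_tendsto_zero] at h3 ⊢
  simp only [norm_pow] at h3
  have h4 := (h3.rpow_const (p := (k : ℝ)⁻¹) (Or.inr (by positivity)))
  rw [Real.zero_rpow (by positivity)] at h4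
  simpa [Real.pow_rpow_inv_natCast (norm_nonneg _) hk] using h4

lemma exists_lt_norm_of_le_re (hg : Differentiable ℂ g) (hC : 0 < C)
    (h : ∀ z, ‖deriv g z‖ ≤ C * (1 + ‖g z‖ ^ 2)) (hκ : κ ≠ 0)
    (hP : ∀ z, logDerivPoly g k z = κ * exp z) (M : ℝ) :
    ∃ X : ℝ, ∀ z : ℂ, X ≤ z.re → M < ‖g z‖ := by
  obtain ⟨B, hB⟩ := exists_norm_logDerivPoly_le_of_norm_le k hC M
  have hκ' : 0 < ‖κ‖ := norm_pos_iff.2 hκ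
  refine ⟨B / ‖κ‖, fun z hz => ?_⟩
  by_contra! hle
  have h1 := hB g z hg h hle
  rw [hP, norm_mul, norm_exp] at h1
  rw [div_le_iff₀ hκ'] at hz
  nlinarith [Real.add_one_le_exp z.re]

lemma exists_norm_deriv_sub_le_of_le_re (hg : Differentiable ℂ g) (hC : 0 < C)
    (h : ∀ z, ‖deriv g z‖ ≤ C * (1 + ‖g z‖ ^ 2)) (hk : k ≠ 0) (hκ : κ ≠ 0)
    (hP : ∀ z, logDerivPoly g k z = κ * exp z) :
    ∃ X B : ℝ, ∀ z : ℂ, X ≤ z.re → ‖deriv g z - g z / k‖ ≤ B := by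
  obtain ⟨A, hA, hQ⟩ := exists_norm_recipPoly_sub_one_le k 1 one_pos
  set Q := recipPoly (fun x => (g x)⁻¹) k with hQdef
  set L := 3 * Real.exp 2 with hL
  set ε := min 1 (2 * A)⁻¹ with hε
  have hε0 : 0 < ε := by positivity
  have hAε : A * ε ≤ 1 / 2 := by
    calc A * ε ≤ A * (2 * A)⁻¹ := by gcongr; exact min_le_right _ _
      _ = 1 / 2 := by field_simp
  obtain ⟨X, hX⟩ := exists_lt_norm_of_le_re hg hC h hκ hP (max ε⁻¹ L)
  have hne : ∀ z : ℂ, X ≤ z.re → g z ≠ 0 := fun z hz => norm_pos_iff.1 <|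
    (inv_pos.2 hε0).trans ((le_max_left _ _).trans_lt (hX z hz))
  have hre : ∀ {x z : ℂ} {r : ℝ}, x ∈ ball z r → z.re - r < x.re ∧ x.re < z.re + r := by
    intro x z r hx
    have h1 := (abs_re_le_norm (x - z)).trans_lt (by rwa [mem_ball, dist_eq_norm] at hx)
    rw [sub_re, abs_lt] at h1
    constructor <;> linarith
  have hQ1 : ∀ z : ℂ, X + 1 ≤ z.re → ‖Q z - 1‖ ≤ 1 / 2 := by
    intro z hz
    have hb : ∀ x ∈ ball z 1, X ≤ x.re := fun x hx => by linarith [(hre hx).1]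
    refine (hQ (fun x => (g x)⁻¹) z ε (min_le_left _ _) (hg.differentiableOn.inv fun x hx => hne x (hb x hx))
      fun x hx => ?_).trans hAε
    rw [norm_inv]
    exact inv_le_of_inv_le₀ hε0 ((le_max_left _ _).trans (hX x (hb x hx)).le)
  have hPQ : ∀ z : ℂ, X ≤ z.re → κ * exp z = g z ^ k * Q z := fun z hz => by
    rw [← hP, logDerivPoly_eq_pow_mul_recipPoly hg k (hne z hz)]
  have hPn : ∀ z : ℂ, X ≤ z.re → ‖κ‖ * Real.exp z.re = ‖g z‖ ^ k * ‖Q z‖ := fun z hz => by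
    rw [← norm_exp, ← norm_mul, hPQ z hz, norm_mul, norm_pow]
  have hQlow : ∀ z : ℂ, X + 1 ≤ z.re → 1 / 2 ≤ ‖Q z‖ := fun z hz => by
    have := norm_sub_norm_le (1 : ℂ) (1 - Q z)
    rw [norm_one, sub_sub_cancel, norm_sub_rev] at this
    linarith [hQ1 z hz]
  have hQup : ∀ z : ℂ, X + 1 ≤ z.re → ‖Q z‖ ≤ 3 / 2 := fun z hz => by
    have := norm_sub_norm_le (Q z) 1
    rw [norm_one] at this
    linarith [hQ1 z hz]
  refine ⟨X + 3, 4 * A * L, fun z hz => ?_⟩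
  have hzX : X ≤ z.re := by linarith
  have hcmp : ∀ x ∈ ball z 2, ‖g z‖ ≤ L * ‖g x‖ := by
    intro x hx
    obtain ⟨h1, h2⟩ := hre hx
    have h3 : ‖g z‖ ^ k * (1 / 2) ≤ Real.exp 2 * (‖g x‖ ^ k * (3 / 2)) := by
      calc ‖g z‖ ^ k * (1 / 2) ≤ ‖g z‖ ^ k * ‖Q z‖ := by gcongr; exact hQlow z (by linarith)
        _ = ‖κ‖ * Real.exp z.re := (hPn z hzX).symm
        _ ≤ ‖κ‖ * Real.exp (2 + x.re) := by gcongr; linarith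
        _ = Real.exp 2 * (‖κ‖ * Real.exp x.re) := by rw [Real.exp_add]; ring
        _ = Real.exp 2 * (‖g x‖ ^ k * ‖Q x‖) := by rw [hPn x (by linarith)]
        _ ≤ _ := by gcongr; exact hQup x (by linarith)
    have hL1 : 1 ≤ L := by linarith [Real.add_one_le_exp 2]
    refine le_of_pow_le_pow_left₀ hk (by positivity) ?_
    calc ‖g z‖ ^ k ≤ L * ‖g x‖ ^ k := by linarith
      _ ≤ L ^ k * ‖g x‖ ^ k := by gcongr; exact le_self_pow₀ hL1 hk
      _ = (L * ‖g x‖) ^ k := (mul_pow _ _ _).symm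
  have hb2 : ∀ x ∈ ball z 2, X ≤ x.re := fun x hx => by linarith [(hre hx).1]
  have hgz : 0 < ‖g z‖ := norm_pos_iff.2 (hne z hzX)
  have hwd : DifferentiableOn ℂ (fun x => (g x)⁻¹) (ball z 2) :=
    hg.differentiableOn.inv fun x hx => hne x (hb2 x hx)
  have hQd : DifferentiableOn ℂ Q (ball z 2) := differentiableOn_recipPoly isOpen_ball hwd k
  have hQs : ∀ y ∈ ball z 1, ‖Q y - 1‖ ≤ A * (L * ‖g z‖⁻¹) := by
    intro y hy
    have hsub : ball y 1 ⊆ ball z 2 := ball_subset_ball' (by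
      rw [mem_ball] at hy; linarith)
    refine hQ _ y _ ?_ (hwd.mono hsub) fun x hx => ?_
    · rw [← div_eq_mul_inv, div_le_one hgz]
      exact (le_max_right _ _).trans (hX z hzX).le
    · have hx' := hsub hx
      have h0 : 0 < ‖g x‖ := norm_pos_iff.2 (hne x (hb2 x hx'))
      rw [norm_inv, ← div_eq_mul_inv, le_div_iff₀ hgz, inv_mul_le_iff₀ h0, mul_comm]
      exact hcmp x hx'
  have hQ' : ‖deriv Q z‖ ≤ 2 * (A * (L * ‖g z‖⁻¹)) := by
    have := norm_deriv_le_of_forall_mem_ball (F := fun y => Q y - 1) one_pos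
      ((hQd.mono (ball_subset_ball one_le_two)).sub_const 1) hQs
    rw [deriv_sub_const] at this
    linarith
  have hzb : z ∈ ball z 2 := mem_ball_self two_pos
  have hQz : HasDerivAt Q (deriv Q z) z :=
    (hQd.differentiableAt (isOpen_ball.mem_nhds hzb)).hasDerivAt
  have hd1 : HasDerivAt (fun x => κ * exp x) (κ * exp z) z := (hasDerivAt_exp z).const_mul κ
  have hd2 : HasDerivAt (fun x => κ * exp x)
      (k * g z ^ (k - 1) * deriv g z * Q z + g z ^ k * deriv Q z) z := by
    refine (((hg z).hasDerivAt.pow k).mul hQz).congr_of_eventuallyEq ?_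
    filter_upwards [isOpen_ball.mem_nhds hzb] with x hx using hPQ x (hb2 x hx)
  have heq := hd1.unique hd2
  rw [hPQ z hzX] at heq
  obtain ⟨m, rfl⟩ := Nat.exists_eq_succ_of_ne_zero hk
  have hg0 := hne z hzX
  have hQ0 : Q z ≠ 0 := norm_pos_iff.1 (by linarith [hQlow z (by linarith)])
  have hk0 : ((m.succ : ℕ) : ℂ) ≠ 0 := Nat.cast_ne_zero.2 hk
  have hid : deriv g z - g z / (m.succ : ℕ) = -(g z * deriv Q z) / ((m.succ : ℕ) * Q z) := by
    have h1 : g z ^ m * (g z * Q z) =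
        g z ^ m * ((m.succ : ℕ) * deriv g z * Q z + g z * deriv Q z) := by
      rw [Nat.succ_sub_one, pow_succ] at heq
      linear_combination heq
    have h2 := mul_left_cancel₀ (pow_ne_zero m hg0) h1
    field_simp
    linear_combination -h2
  rw [hid, norm_div, norm_neg, norm_mul, norm_mul, Complex.norm_natCast]
  have hk1 : (1 : ℝ) ≤ (m.succ : ℕ) := by exact_mod_cast Nat.succ_pos m
  have hQl := hQlow z (by linarith)
  rw [div_le_iff₀ (by positivity)]
  calc ‖g z‖ * ‖deriv Q z‖ ≤ ‖g z‖ * (2 * (A * (L * ‖g z‖⁻¹))) := by gcongr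
    _ = 4 * A * L * (1 * (1 / 2)) := by field_simp; ring
    _ ≤ _ := by gcongr

lemma deriv_eq_div_of_logDerivPoly_eq (hg : Differentiable ℂ g) (hC : 0 < C)
    (h : ∀ z, ‖deriv g z‖ ≤ C * (1 + ‖g z‖ ^ 2)) (hk : k ≠ 0) (hκ : κ ≠ 0)
    (hP : ∀ z, logDerivPoly g k z = κ * exp z) (z : ℂ) : deriv g z = g z / k := by
  obtain ⟨X, B, hB⟩ := exists_norm_deriv_sub_le_of_le_re hg hC h hk hκ hP
  obtain ⟨M, hM⟩ := exists_norm_le_of_re_le hg hC h hk hP X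
  obtain ⟨c, hc⟩ := ((differentiable_deriv_of_entire hg).sub
    (hg.div_const (k : ℂ))).exists_const_forall_eq_of_bounded (isBounded_iff_forall_norm_le.2
    ⟨max B (C * (1 + M ^ 2) + M / k), by
      rintro _ ⟨x, rfl⟩
      rcases le_total X x.re with hx | hx
      · exact (hB x hx).trans (le_max_left _ _)
      · refine (le_trans (norm_sub_le _ _) ?_).trans (le_max_right _ _)
        rw [norm_div, Complex.norm_natCast]
        have := hM x hx
        gcongr
        exact (h x).trans (by gcongr)⟩)
  have hlim : Tendsto (fun z => deriv g z - g z / k) (comap re atBot) (𝓝 0) := by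
    simpa using (tendsto_deriv_of_norm_le_of_re_le hg hM).sub
      ((tendsto_zero_of_logDerivPoly_eq hg hC h hk hP).div_const (k : ℂ))
  have : (comap re atBot).NeBot := atBot_neBot.comap_of_surj re_surjective
  have hc0 : c = 0 := tendsto_nhds_unique
    (tendsto_const_nhds.congr fun z => (hc z).symm) hlim
  have := hc z
  rw [hc0] at this
  exact sub_eq_zero.1 this

open Polynomial in
lemma exists_eval_eq_logDerivPoly (hg : Differentiable ℂ g) {c : ℂ} (hc : c ≠ 0)
    (h : ∀ z, deriv g z = c * g z) (k : ℕ) :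
    ∃ q : ℂ[X], q.eval 0 ≠ 0 ∧ ∀ z, logDerivPoly g (k + 1) z = g z * q.eval (g z) := by
  induction k with
  | zero => exact ⟨1, by simp, fun z => by simp [logDerivPoly]⟩
  | succ k ih =>
    obtain ⟨q, hq, hqz⟩ := ih
    refine ⟨Polynomial.C c * (q + X * derivative q) + X * q, by simp [hc, hq], fun z => ?_⟩
    have hd := (hg z).hasDerivAt.mul
      ((q.hasDerivAt (g z)).comp z (hg z).hasDerivAt)
    rw [logDerivPoly_succ, show logDerivPoly g (k + 1) = fun z => g z * q.eval (g z) from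
      funext hqz]
    have hd' := hd.deriv
    simp only [Function.comp_def] at hd'
    erw [hd']
    simp [h]
    ring

lemma logDerivPoly_ne_mul_exp (hg : Differentiable ℂ g) (hC : 0 < C)
    (h : ∀ z, ‖deriv g z‖ ≤ C * (1 + ‖g z‖ ^ 2)) (hk : 2 ≤ k) (hκ : κ ≠ 0) :
    ¬ ∀ z, logDerivPoly g k z = κ * exp z := by
  intro hP
  have hk0 : k ≠ 0 := by lia
  have hkC : (k : ℂ) ≠ 0 := Nat.cast_ne_zero.2 hk0
  have hd := deriv_eq_div_of_logDerivPoly_eq hg hC h hk0 hκ hP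
  have hlim := tendsto_zero_of_logDerivPoly_eq hg hC h hk0 hP
  obtain ⟨m, rfl⟩ : ∃ m, k = m + 2 := ⟨k - 2, by lia⟩
  obtain ⟨q, hq, hqz⟩ := exists_eval_eq_logDerivPoly hg (inv_ne_zero hkC)
    (fun z => by rw [hd z, div_eq_inv_mul]) (m + 1)
  have hg0 : ∀ z, g z ≠ 0 := fun z hz => by
    have := hqz z
    rw [hP, hz, zero_mul] at this
    exact mul_ne_zero hκ (exp_ne_zero z) this
  have hexp : ∀ z, g z ^ (m + 2) = g 0 ^ (m + 2) * exp z := by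
    intro z
    have hder : ∀ x, HasDerivAt (fun x => g x ^ (m + 2) * exp (-x)) 0 x := by
      intro x
      convert! ((hg x).hasDerivAt.pow (m + 2)).mul ((hasDerivAt_neg x).cexp) using 1
      rw [hd x]
      field_simp
      simp
      ring
    have := is_const_of_deriv_eq_zero (fun x => (hder x).differentiableAt)
      (fun x => (hder x).deriv) z 0
    simp only [neg_zero, exp_zero, mul_one] at this
    rw [← this, mul_assoc, ← exp_add]
    simp
  have hqg : ∀ z, q.eval (g z) = κ / g 0 ^ (m + 2) * g z ^ (m + 1) := by
    intro z
    have h1 := hqz z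
    rw [hP] at h1
    have h2 := hexp z
    have h3 := hg0 0
    refine mul_left_cancel₀ (hg0 z) ?_
    rw [← h1]
    field_simp
    rw [mul_comm, ← h2]
    ring
  have : (comap re atBot).NeBot := atBot_neBot.comap_of_surj re_surjective
  have h1 : Tendsto (fun z => q.eval (g z)) (comap re atBot) (𝓝 (q.eval 0)) :=
    (q.continuous.tendsto 0).comp hlim
  have h2 : Tendsto (fun z => q.eval (g z)) (comap re atBot) (𝓝 0) := by
    simp only [hqg]
    simpa using (hlim.pow (m + 1)).const_mul (κ / g 0 ^ (m + 2))
  exact hq (tendsto_nhds_unique h1 h2)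

lemma deriv_eq_zero_of_logDerivPoly_ne_zero (hg : Differentiable ℂ g) (hC : 0 < C)
    (h : ∀ z, ‖deriv g z‖ ≤ C * (1 + ‖g z‖ ^ 2)) (hk : 2 ≤ k)
    (hP : ∀ z, logDerivPoly g k z ≠ 0) (z : ℂ) : deriv g z = 0 := by
  obtain ⟨A, B, -, -, hAB⟩ := exists_norm_logDerivPoly_le_exp hg
    (exists_norm_le_exp_of_norm_deriv_le hg hC h) k
  obtain ⟨α, β, hαβ⟩ := eq_exp_affine_of_norm_le (differentiable_logDerivPoly hg k) hP hAB
  rcases eq_or_ne α 0 with rfl | hα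
  · exact deriv_eq_zero_of_norm_logDerivPoly_le hg hC h (by lia : k ≠ 0) (B := ‖exp β‖)
      (fun z => by simp [hαβ]) z
  exfalso
  set ν := -β / α with hν
  have haff : ∀ z, HasDerivAt (fun z => α⁻¹ * z + ν) α⁻¹ z := fun z => by
    simpa using ((hasDerivAt_id z).const_mul α⁻¹).add_const ν
  have hder : ∀ z, HasDerivAt (fun z => α⁻¹ * g (α⁻¹ * z + ν))
      (α⁻¹ * (deriv g (α⁻¹ * z + ν) * α⁻¹)) z := fun z =>
    ((hg _).hasDerivAt.comp z (haff z)).const_mul α⁻¹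
  refine logDerivPoly_ne_mul_exp (g := fun z => α⁻¹ * g (α⁻¹ * z + ν))
    (C := C * (‖α⁻¹‖ ^ 2 + 1)) (κ := α⁻¹ ^ k) (fun z => (hder z).differentiableAt)
    (by positivity) (fun z => ?_) hk (pow_ne_zero _ (inv_ne_zero hα)) fun z => ?_
  · rw [(hder z).deriv, norm_mul, norm_mul, norm_mul]
    have h1 := h (α⁻¹ * z + ν)
    have h2 := sq_nonneg ‖α⁻¹‖
    calc ‖α⁻¹‖ * (‖deriv g (α⁻¹ * z + ν)‖ * ‖α⁻¹‖)
        ≤ ‖α⁻¹‖ * (C * (1 + ‖g (α⁻¹ * z + ν)‖ ^ 2) * ‖α⁻¹‖) := by gcongr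
      _ = C * (‖α⁻¹‖ ^ 2 + (‖α⁻¹‖ * ‖g (α⁻¹ * z + ν)‖) ^ 2) := by ring
      _ ≤ C * ((‖α⁻¹‖ ^ 2 + 1) * (1 + (‖α⁻¹‖ * ‖g (α⁻¹ * z + ν)‖) ^ 2)) := by
        gcongr
        nlinarith [mul_nonneg h2 (sq_nonneg (‖α⁻¹‖ * ‖g (α⁻¹ * z + ν)‖))]
      _ = _ := by ring
  · have hz : α * (α⁻¹ * z + ν) + β = z := by
      rw [hν]
      field_simp
      ring
    simp only [logDerivPoly_comp_affine hg, hαβ, hz]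

end ExponentialDifferentialPolynomial

/-- Rescaling an entire function around a maximum point of a weighted derivative. -/
lemma exists_rescale_norm_deriv_le {u : ℂ → ℂ} (hu : Differentiable ℂ u) {a : ℂ}
    (ha : ‖u a‖ ^ 2 < ‖deriv u a‖) {R : ℝ} (hR : 0 < R) :
    ∃ μ b : ℂ, μ ≠ 0 ∧
      (∀ z ∈ ball (0 : ℂ) R, ‖deriv (fun z => μ * u (μ * z + b)) z‖ ≤
        4 * (1 + ‖μ * u (μ * z + b)‖ ^ 2)) ∧
      ‖deriv (fun z => μ * u (μ * z + b)) 0‖ = 1 + ‖μ * u (μ * 0 + b)‖ ^ 2 := by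
  set T : ℂ → ℝ := fun z => Real.sqrt (‖deriv u z‖ - ‖u z‖ ^ 2) with hT
  have hTc : Continuous T := ((differentiable_deriv_of_entire hu).continuous.norm.sub
    (hu.continuous.norm.pow 2)).sqrt
  have hTa : 0 < T a := Real.sqrt_pos.2 (by linarith)
  set r := 2 * R / T a with hr
  have hr0 : 0 < r := by positivity
  obtain ⟨b, hb, hmax⟩ := (isCompact_closedBall a r).exists_isMaxOn
    (f := fun z => (r - dist z a) * T z) ⟨a, mem_closedBall_self hr0.le⟩ (by fun_prop)
  have hmax' : ∀ z ∈ closedBall a r, (r - dist z a) * T z ≤ (r - dist b a) * T b :=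
    fun z hz => hmax hz
  have h1 := hmax' a (mem_closedBall_self hr0.le)
  have hrT : r * T a = 2 * R := by rw [hr]; field_simp
  rw [dist_self, sub_zero, hrT] at h1
  set s := r - dist b a with hs
  have hs0 : 0 ≤ s := by rw [hs]; linarith [mem_closedBall.1 hb]
  have hTb0 : 0 ≤ T b := Real.sqrt_nonneg _
  have hTb : 0 < T b := by
    refine hTb0.lt_of_ne fun h0 => ?_
    rw [← h0, mul_zero] at h1
    linarith
  have hspos : 0 < s := by
    refine hs0.lt_of_ne fun h0 => ?_
    rw [← h0, zero_mul] at h1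
    linarith
  set μ : ℂ := (((T b)⁻¹ : ℝ) : ℂ) with hμ
  have hμn : ‖μ‖ = (T b)⁻¹ := by rw [hμ, norm_real, Real.norm_of_nonneg (by positivity)]
  have hder : ∀ z, ‖deriv (fun z => μ * u (μ * z + b)) z‖ = ‖μ‖ ^ 2 * ‖deriv u (μ * z + b)‖ := by
    intro z
    have haff : HasDerivAt (fun z => μ * z + b) μ z := by
      simpa using ((hasDerivAt_id z).const_mul μ).add_const b
    have := (((hu _).hasDerivAt.comp z haff).const_mul μ).deriv
    rw [show (fun z => μ * u (μ * z + b)) = fun z => μ * (u ∘ fun z => μ * z + b) z from rfl, this,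
      norm_mul, norm_mul]
    ring
  have hTle : ∀ z, ‖deriv u z‖ - ‖u z‖ ^ 2 ≤ T z ^ 2 := fun z => by
    rw [hT, Real.sq_sqrt']
    exact le_max_left _ _
  refine ⟨μ, b, by rw [hμ]; exact_mod_cast (inv_pos.2 hTb).ne', fun z hz => ?_, ?_⟩
  · rw [hder, norm_mul, hμn]
    set x := μ * z + b with hx
    have hxb : dist x b ≤ s / 2 := by
      rw [dist_eq_norm, hx, add_sub_cancel_right, norm_mul, hμn, inv_mul_le_iff₀ hTb]
      rw [mem_ball_zero_iff] at hz
      linarith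
    have hxa := dist_triangle x b a
    have h2 := hmax' x (by rw [mem_closedBall]; linarith)
    have h3 : s / 2 * T x ≤ s / 2 * (2 * T b) := by
      calc s / 2 * T x ≤ (r - dist x a) * T x := by
            have : 0 ≤ T x := Real.sqrt_nonneg _
            gcongr
            linarith
        _ ≤ s * T b := h2
        _ = _ := by ring
    have h4 : T x ≤ 2 * T b := le_of_mul_le_mul_left h3 (by linarith)
    have h5 : ‖deriv u x‖ ≤ (2 * T b) ^ 2 + ‖u x‖ ^ 2 := by
      have := hTle x
      have : T x ^ 2 ≤ (2 * T b) ^ 2 := pow_le_pow_left₀ (Real.sqrt_nonneg _) h4 2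
      linarith
    calc (T b)⁻¹ ^ 2 * ‖deriv u x‖ ≤ (T b)⁻¹ ^ 2 * ((2 * T b) ^ 2 + ‖u x‖ ^ 2) := by gcongr
      _ = 4 + ((T b)⁻¹ * ‖u x‖) ^ 2 := by field_simp; ring
      _ ≤ _ := by linarith [sq_nonneg ((T b)⁻¹ * ‖u x‖)]
  · rw [hder, norm_mul, hμn, mul_zero, zero_add]
    have : ‖deriv u b‖ = T b ^ 2 + ‖u b‖ ^ 2 := by
      rw [hT, Real.sq_sqrt (Real.sqrt_pos.1 hTb).le]
      ring
    rw [this]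
    field_simp

lemma norm_le_of_norm_deriv_eq {g : ℂ → ℂ} (hg : Differentiable ℂ g)
    (h : ∀ z ∈ ball (0 : ℂ) 1, ‖deriv g z‖ ≤ 4 * (1 + ‖g z‖ ^ 2))
    (h0 : ‖deriv g 0‖ = 1 + ‖g 0‖ ^ 2) : ‖g 0‖ ≤ 128 ^ 3 := by
  by_contra! hlt
  have hw : ∀ z ∈ ball (0 : ℂ) (1 / 16 / 2), g z ≠ 0 ∧ ‖(g z)⁻¹‖ ≤ 1 / 128 := fun z hz =>
    norm_inv_le_of_one_le_mul hg (by norm_num) (by norm_num)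
      (fun x hx => h x (ball_subset_ball (by norm_num) hx)) (by linarith) (by norm_num)
      (by linarith) hz
  have hg0 := (hw 0 (mem_ball_self (by norm_num))).1
  have hd := norm_deriv_le_of_forall_mem_ball (F := fun z => (g z)⁻¹) (by norm_num)
    (hg.differentiableOn.inv fun x hx => (hw x hx).1) fun z hz => (hw z hz).2
  rw [((hg 0).hasDerivAt.fun_inv hg0).deriv, norm_div, norm_neg, norm_pow, h0,
    div_le_iff₀ (by positivity)] at hd
  nlinarith [sq_nonneg ‖g 0‖]

lemma exists_eventually_norm_le {G : ℕ → ℂ → ℂ} (hG : ∀ n, Differentiable ℂ (G n))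
    (h : ∀ n : ℕ, ∀ z ∈ ball (0 : ℂ) (n + 1), ‖deriv (G n) z‖ ≤ 4 * (1 + ‖G n z‖ ^ 2)) {M : ℝ}
    (h0 : ∀ n, ‖G n 0‖ ≤ M) (R : ℝ) :
    ∃ B : ℝ, ∀ᶠ n in atTop, ∀ z ∈ ball (0 : ℂ) R, ‖G n z‖ ≤ B := by
  have key : ∀ m : ℕ, ∃ B : ℝ, ∀ᶠ n in atTop, ∀ z : ℂ, ‖z‖ ≤ m / 40 → ‖G n z‖ ≤ B := by
    intro m
    induction m with
    | zero =>
      refine ⟨M, .of_forall fun n z hz => ?_⟩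
      have hz0 : z = 0 := by simpa using hz
      rw [hz0]
      exact h0 n
    | succ m ih =>
      obtain ⟨B, hB⟩ := ih
      refine ⟨max 2 (B ^ 3), ?_⟩
      filter_upwards [hB, eventually_ge_atTop m] with n hn hmn z hz
      have hmn' : (m : ℝ) ≤ n := by exact_mod_cast hmn
      push_cast at hz
      set t : ℝ := m / (m + 1) with ht
      have htz : ‖(t : ℂ) * z‖ ≤ m / 40 := by
        rw [norm_mul, norm_real, Real.norm_of_nonneg (by positivity)]
        calc t * ‖z‖ ≤ t * ((m + 1) / 40) := by gcongr
          _ = m / 40 := by rw [ht]; field_simp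
      have hdist : dist z ((t : ℂ) * z) ≤ 1 / 40 := by
        have h1 : z - (t : ℂ) * z = ((1 - t : ℝ) : ℂ) * z := by push_cast; ring
        have h2 : 1 - t = ((m : ℝ) + 1)⁻¹ := by rw [ht]; field_simp; ring
        rw [dist_eq_norm, h1, norm_mul, norm_real, h2, Real.norm_of_nonneg (by positivity),
          inv_mul_le_iff₀ (by positivity)]
        linarith
      refine (norm_le_max_of_mem_ball (C := 4) (a := (t : ℂ) * z) (δ := 1 / 16) (hG n) (by norm_num)
        (by norm_num) (fun x hx => h n x ?_) (by rw [mem_ball]; linarith)).trans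
        (by gcongr; exact hn _ htz)
      rw [mem_ball, dist_eq_norm] at hx
      rw [mem_ball_zero_iff]
      linarith [norm_le_norm_add_norm_sub' x z, Nat.cast_nonneg (α := ℝ) m]
  obtain ⟨m, hm⟩ := exists_nat_ge (40 * R)
  obtain ⟨B, hB⟩ := key m
  refine ⟨B, hB.mono fun n hn z hz => hn z ?_⟩
  rw [mem_ball_zero_iff] at hz
  linarith

/-- Montel's theorem along an ultrafilter. -/
lemma exists_tendstoLocallyUniformlyOn_of_norm_le {ι : Type*} (l : Ultrafilter ι)
    {G : ι → ℂ → ℂ} (hG : ∀ n, Differentiable ℂ (G n))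
    (h : ∀ R : ℝ, ∃ B : ℝ, ∀ᶠ n in l, ∀ z ∈ ball (0 : ℂ) R, ‖G n z‖ ≤ B) :
    ∃ g : ℂ → ℂ, TendstoLocallyUniformlyOn G g l univ := by
  have hpt : ∀ z, ∃ y, Tendsto (fun n => G n z) l (𝓝 y) := by
    intro z
    obtain ⟨B, hB⟩ := h (‖z‖ + 1)
    obtain ⟨y, -, hy⟩ := (isCompact_closedBall (0 : ℂ) B).ultrafilter_le_nhds
      (l.map fun n => G n z) (by
        rw [Ultrafilter.coe_map, le_principal_iff, Filter.mem_map]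
        filter_upwards [hB] with n hn
        simpa using hn z (by simp))
    exact ⟨y, hy⟩
  choose g hg using hpt
  refine ⟨g, Metric.tendstoLocallyUniformlyOn_iff.2 fun ε hε x _ => ?_⟩
  obtain ⟨B, hB⟩ := h (‖x‖ + 2)
  set L := max (2 * B) 1 with hL
  have hL0 : 0 < L := by positivity
  have hLip : ∀ᶠ n in l, ∀ y ∈ ball x 1, ‖G n y - G n x‖ ≤ L * ‖y - x‖ := by
    filter_upwards [hB] with n hn y hy
    refine (convex_ball x 1).norm_image_sub_le_of_norm_deriv_le (fun z _ => hG n z)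
      (fun z hz => ?_) (mem_ball_self one_pos) hy
    refine (norm_deriv_le_of_forall_mem_ball one_pos (hG n).differentiableOn
      (C := B) fun w hw => hn w ?_).trans (by rw [hL]; exact le_trans (by linarith) (le_max_left _ _))
    rw [mem_ball, dist_eq_norm] at hz hw
    rw [mem_ball_zero_iff]
    linarith [norm_le_norm_add_norm_sub' w z, norm_le_norm_add_norm_sub' z x]
  have hLipg : ∀ y ∈ ball x 1, ‖g y - g x‖ ≤ L * ‖y - x‖ := fun y hy =>
    le_of_tendsto ((hg y).sub (hg x)).norm (hLip.mono fun n hn => hn y hy)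
  refine ⟨ball x (min 1 (ε / (3 * L))), mem_nhdsWithin_of_mem_nhds (ball_mem_nhds _ (by positivity)),
    ?_⟩
  filter_upwards [hLip, Metric.tendsto_nhds.1 (hg x) (ε / 3) (by positivity)] with n hn hnx y hy
  rw [mem_ball, lt_min_iff] at hy
  have h1 := hn y hy.1
  have h2 := hLipg y hy.1
  have h3 : L * ‖y - x‖ < ε / 3 := by
    rw [← dist_eq_norm]
    calc L * dist y x < L * (ε / (3 * L)) := by gcongr; exact hy.2
      _ = ε / 3 := by field_simp
  rw [dist_eq_norm] at hnx ⊢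
  calc ‖g y - G n y‖ = ‖(g y - g x) - (G n y - G n x) - (G n x - g x)‖ := by congr 1; ring
    _ ≤ ‖g y - g x‖ + ‖G n y - G n x‖ + ‖G n x - g x‖ :=
      (norm_sub_le _ _).trans (by gcongr; exact norm_sub_le _ _)
    _ < ε := by linarith

/-- An entire function with a zero-free differential polynomial `logDerivPoly u k`, `2 ≤ k`, is
constant. -/
lemma deriv_eq_zero_of_forall_logDerivPoly_ne_zero {u : ℂ → ℂ} (hu : Differentiable ℂ u) {k : ℕ}
    (hk : 2 ≤ k) (hP : ∀ z, logDerivPoly u k z ≠ 0) (z : ℂ) : deriv u z = 0 := by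
  by_cases hcase : ∀ z, ‖deriv u z‖ ≤ ‖u z‖ ^ 2
  · exact deriv_eq_zero_of_logDerivPoly_ne_zero hu one_pos
      (fun z => by linarith [hcase z]) hk hP z
  push Not at hcase
  obtain ⟨a, ha⟩ := hcase
  exfalso
  choose μ b hμ hder hder0 using fun n : ℕ =>
    exists_rescale_norm_deriv_le hu ha (R := n + 1) (by positivity)
  set G : ℕ → ℂ → ℂ := fun n z => μ n * u (μ n * z + b n) with hG
  have hGd : ∀ n, Differentiable ℂ (G n) := fun n =>
    (hu.comp ((differentiable_id.const_mul (μ n)).add_const (b n))).const_mul (μ n)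
  have hG0 : ∀ n, ‖G n 0‖ ≤ 128 ^ 3 := fun n =>
    norm_le_of_norm_deriv_eq (hGd n) (fun z hz => hder n z
      (ball_subset_ball (by linarith [Nat.cast_nonneg (α := ℝ) n]) hz)) (hder0 n)
  have hle : ((hyperfilter ℕ : Ultrafilter ℕ) : Filter ℕ) ≤ atTop := Nat.hyperfilter_le_atTop
  obtain ⟨g, hg⟩ := exists_tendstoLocallyUniformlyOn_of_norm_le (hyperfilter ℕ) hGd fun R => by
    obtain ⟨B, hB⟩ := exists_eventually_norm_le hGd hder hG0 R
    exact ⟨B, hle hB⟩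
  have hgd : Differentiable ℂ g := differentiableOn_univ.1
    (hg.differentiableOn (.of_forall fun n => (hGd n).differentiableOn) isOpen_univ)
  have hg' := hg.deriv (.of_forall fun n => (hGd n).differentiableOn) isOpen_univ
  have hgz : ∀ z, Tendsto (fun n => G n z) (hyperfilter ℕ) (𝓝 (g z)) := fun z =>
    hg.tendsto_at (mem_univ z)
  have hgz' : ∀ z, Tendsto (fun n => deriv (G n) z) (hyperfilter ℕ) (𝓝 (deriv g z)) := fun z =>
    hg'.tendsto_at (mem_univ z)
  have hbd : ∀ z, ‖deriv g z‖ ≤ 4 * (1 + ‖g z‖ ^ 2) := fun z =>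
    le_of_tendsto_of_tendsto (hgz' z).norm ((((hgz z).norm.pow 2).const_add 1).const_mul 4) (by
      filter_upwards [hle (eventually_ge_atTop ⌈‖z‖⌉₊)] with n hn
      refine hder n z ?_
      rw [mem_ball_zero_iff]
      have := Nat.ceil_le.1 hn
      linarith)
  have h0 : ‖deriv g 0‖ = 1 + ‖g 0‖ ^ 2 :=
    tendsto_nhds_unique (hgz' 0).norm ((((hgz 0).norm.pow 2).const_add 1).congr
      fun n => (hder0 n).symm)
  have hPg : (∀ z, logDerivPoly g k z = 0) ∨ ∀ z, logDerivPoly g k z ≠ 0 := by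
    refine eq_zero_or_ne_zero_of_tendstoLocallyUniformlyOn
      (fun n => differentiable_logDerivPoly (hGd n) k) (fun n z => ?_)
      (tendsto_logDerivPoly hGd hg k)
    simp only [hG, logDerivPoly_comp_affine hu]
    exact mul_ne_zero (pow_ne_zero _ (hμ n)) (hP _)
  have hzero : deriv g 0 = 0 := by
    rcases hPg with hPg | hPg
    · exact deriv_eq_zero_of_norm_logDerivPoly_le hgd four_pos hbd (by lia : k ≠ 0) (B := 0)
        (fun z => by simp [hPg]) 0
    · exact deriv_eq_zero_of_logDerivPoly_ne_zero hgd four_pos hbd hk hPg 0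
  rw [hzero, norm_zero] at h0
  linarith [sq_nonneg ‖g 0‖]

/-- If `f` is a non-constant entire function with `S_k(f)(z) ≠ 0` and
`S_k(f)(z) ≠ ∞` for all `z ∈ ℂ` (the latter meaning that `f'` has no zeros),
then `f(z) = a·e^{bz} + c` with `a, b ≠ 0`. -/
theorem entire_Sk_ne_zero (k : ℕ) (hk : 2 ≤ k) (f : ℂ → ℂ)
    (hf : Differentiable ℂ f) (hnc : ¬ ∃ c : ℂ, f = fun _ => c)
    (hpole : ∀ z : ℂ, deriv f z ≠ 0)
    (hzero : ∀ z : ℂ, Sk k f z ≠ 0) :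
    ∃ a b c : ℂ, a ≠ 0 ∧ b ≠ 0 ∧ ∀ z : ℂ, f z = a * Complex.exp (b * z) + c := by
  have hk0 : (k : ℂ) ≠ 0 := Nat.cast_ne_zero.2 (by lia)
  have hf' := differentiable_deriv_of_entire hf
  have hu : Differentiable ℂ fun z => -(1 / (k : ℂ)) * ldd f z :=
    ((differentiable_deriv_of_entire hf').div hf' hpole).const_mul _
  have hSk : ∀ z, Sk k f z = -(k : ℂ) * logDerivPoly (fun z => -(1 / (k : ℂ)) * ldd f z) k z := by
    intro z
    rw [Sk, SGen, SRec_eq_logDerivPoly (by lia) hu, show k + 1 - 2 + 1 = k by lia]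
  have hder := deriv_eq_zero_of_forall_logDerivPoly_ne_zero hu hk fun z h =>
    hzero z (by rw [hSk, h, mul_zero])
  set b := ldd f 0 with hb
  have hldd : ∀ z, ldd f z = b := fun z => mul_left_cancel₀ (neg_ne_zero.2 (one_div_ne_zero hk0))
    (is_const_of_deriv_eq_zero hu hder z 0)
  have hb0 : b ≠ 0 := by
    intro h0
    obtain ⟨m, rfl⟩ : ∃ m, k = m + 1 := ⟨k - 1, by lia⟩
    have hz : ldd f = fun _ => 0 := funext fun z => by rw [hldd, h0]
    have hS : ∀ n m, SRec n f m = fun _ => 0 := fun n m => by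
      induction m with
      | zero => exact hz
      | succ m ih => funext z; simp [SRec, ih]
    exact hzero 0 (by rw [Sk, SGen, hS])
  have hff : ∀ z, deriv (deriv f) z = b * deriv f z := fun z => by
    rw [← hldd z, ldd, div_mul_cancel₀ _ (hpole z)]
  refine ⟨deriv f 0 / b, b, f 0 - deriv f 0 / b, div_ne_zero (hpole 0) hb0, hb0, fun z => ?_⟩
  have hexp : ∀ z, deriv f z = deriv f 0 * exp (b * z) := fun z =>
    eq_mul_exp_of_hasDerivAt (L := fun z => b * z) isOpen_univ isPreconnected_univ
      hf'.differentiableOn (fun z _ => hpole z)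
      (fun z _ => by
        convert! (hasDerivAt_id z).const_mul b using 1
        rw [hff z, mul_div_cancel_right₀ _ (hpole z), mul_one])
      (mem_univ 0) (by simp) (mem_univ z)
  have hd : ∀ x, HasDerivAt (fun x => f x - deriv f 0 / b * exp (b * x)) 0 x := fun x => by
    convert! (hf x).hasDerivAt.sub
      ((((hasDerivAt_id x).const_mul b).cexp).const_mul (deriv f 0 / b)) using 1
    rw [hexp x]
    simp
    field_simp
    ring
  have := is_const_of_deriv_eq_zero (fun x => (hd x).differentiableAt) (fun x => (hd x).deriv) z 0
  simp only [mul_zero, exp_zero, mul_one] at this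
  linear_combination this
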